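/- arXiv:0812.4776 — 3 statements merged into one kernel-verified Lean document; each statement's English description precedes it below -/
import Mathlib

section
/- Reflection property for exponential operators: for every a ∈ ℂ, every N ≥ 0, and every admissible tuple X = (x_1,…,x_N), J_{N,a}(X) = J_{N,−a}(X). (This expresses the identity f_a(θ_1,…,θ_N) = f_{−a}(θ_1,…,θ_N) between the breather form factors of the exponential fields e^{iαφ} and e^{i(2α_0−α)φ}.) -/
open Finset Filter Complex

/-- The function `f(x) = (x+ω)(x−ω⁻¹)/(x²−1)`. -/
noncomputable def ff (ω x : ℂ) : ℂ := (x + ω) * (x - ω⁻¹) / (x ^ 2 - 1)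

/-- The power sum `S_m` (with `m ∈ ℤ`) of the entries `X i`, `i ∈ I`. -/
noncomputable def pS (m : ℤ) {N : ℕ} (X : Fin N → ℂ) (I : Finset (Fin N)) : ℂ :=
  ∑ i ∈ I, X i ^ m

/-- The polynomial `P^h(X_-|X_+) = ∏_{m=1}^s (S_m(X_-) − (−1)^m S_m(X_+))^{k_m}` of the
partition `h` with multiplicities `k` (with `k m` parts equal to `m`, `1 ≤ m ≤ s`),
evaluated on the entries of `X` indexed by `Im` and `Ip`. -/
noncomputable def Ph (k : ℕ → ℕ) (s : ℕ) {N : ℕ} (X : Fin N → ℂ)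
    (Im Ip : Finset (Fin N)) : ℂ :=
  ∏ m ∈ Finset.Icc 1 s, (pS (m : ℤ) X Im - (-1 : ℂ) ^ m * pS (m : ℤ) X Ip) ^ k m

/-- A tuple is admissible if all entries are nonzero and `x_i ≠ ±x_j` for `i ≠ j`. -/
def Admissible {N : ℕ} (X : Fin N → ℂ) : Prop :=
  (∀ i, X i ≠ 0) ∧ ∀ i j, i ≠ j → X i ≠ X j ∧ X i ≠ -X j

/-- The phase factor `e^{iπa(#I_- − #I_+)}` where `#I_- = c`, `#I_+ = N − c`. -/
noncomputable def phase (a : ℂ) (N c : ℕ) : ℂ :=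
  Complex.exp (Complex.I * (Real.pi : ℂ) * a * (2 * (c : ℂ) - (N : ℂ)))

/-- The descendant function
`J^h_{N,a}(X) = Σ_{I_- ⊔ I_+} e^{iπa(#I_- − #I_+)} P^h(X_-|X_+) ∏_{i∈I_-, j∈I_+} f(x_i/x_j)`. -/
noncomputable def J (ω : ℂ) (k : ℕ → ℕ) (s : ℕ) (a : ℂ) {N : ℕ} (X : Fin N → ℂ) : ℂ :=
  ∑ I : Finset (Fin N),
    phase a N I.card * Ph k s X I Iᶜ * ∏ i ∈ I, ∏ j ∈ Iᶜ, ff ω (X i / X j)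

/-- The exponential-field function `J_{N,a}(X)` (the case `P^h = 1`). -/
noncomputable def Jexp (ω a : ℂ) {N : ℕ} (X : Fin N → ℂ) : ℂ :=
  ∑ I : Finset (Fin N),
    phase a N I.card * ∏ i ∈ I, ∏ j ∈ Iᶜ, ff ω (X i / X j)

/-- The numerator `(s + ω y) (s - ω⁻¹ y)` of `f (s / y)`. -/
noncomputable def ffNum (ω s y : ℂ) : ℂ := (s + ω * y) * (s - ω⁻¹ * y)

lemma ff_div (ω : ℂ) {s y : ℂ} (hy : y ≠ 0) :
    ff ω (s / y) = ffNum ω s y / (s ^ 2 - y ^ 2) := by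
  have h1 : (s / y + ω) * (s / y - ω⁻¹) = ffNum ω s y / y ^ 2 := by
    rw [ffNum]; field_simp
  have h2 : (s / y) ^ 2 - 1 = (s ^ 2 - y ^ 2) / y ^ 2 := by
    field_simp
  rw [ff, h1, h2, div_div_div_cancel_right₀ (pow_ne_zero 2 hy)]

lemma ffNum_swap {ω : ℂ} (hω : ω ≠ 0) (s y : ℂ) : ffNum ω y s = -ffNum ω (-s) y := by
  simp only [ffNum]; field_simp; ring

/-- Clearing the denominator of `f (s / y)`. -/
lemma ff_div_mul (ω : ℂ) {s y : ℂ} (hy : y ≠ 0) (h : s ^ 2 - y ^ 2 ≠ 0) :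
    ff ω (s / y) * (s ^ 2 - y ^ 2) = ffNum ω s y := by
  rw [ff_div ω hy, div_mul_cancel₀ _ h]

/-- Clearing the denominator of `f (y / s)`. -/
lemma ff_div_swap_mul {ω : ℂ} (hω : ω ≠ 0) {s y : ℂ} (hs : s ≠ 0) (h : s ^ 2 - y ^ 2 ≠ 0) :
    ff ω (y / s) * (s ^ 2 - y ^ 2) = ffNum ω (-s) y := by
  rw [ff_div ω hs, ffNum_swap hω, ← neg_sub (s ^ 2), neg_div_neg_eq, div_mul_cancel₀ _ h]

section Configurations

variable {ι : Type*}

/-- The numerator, as a function of the added entry `s`, of the terms where `s` joins `I`. -/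
noncomputable def joinNum (ω s : ℂ) (x : ι → ℂ) (I K : Finset ι) : ℂ :=
  (∏ j ∈ K, ffNum ω s (x j)) * ∏ i ∈ I, (s ^ 2 - x i ^ 2)

open Polynomial in
lemma exists_polynomial_joinNum (ω c : ℂ) (x : ι → ℂ) (I K : Finset ι) :
    ∃ p : ℂ[X], p.natDegree ≤ 2 * (#K + #I) ∧ ∀ s, p.eval s = joinNum ω (c * s) x I K := by
  refine ⟨(∏ j ∈ K, (C c * X + C (ω * x j)) * (C c * X - C (ω⁻¹ * x j))) *
    ∏ i ∈ I, ((C c * X) ^ 2 - C (x i ^ 2)), ?_, fun s => ?_⟩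
  · have h1 : ∀ j ∈ K, ((C c * X + C (ω * x j)) * (C c * X - C (ω⁻¹ * x j))).natDegree ≤ 2 :=
      fun j _ => by compute_degree
    have h2 : ∀ i ∈ I, ((C c * X) ^ 2 - C (x i ^ 2)).natDegree ≤ 2 :=
      fun i _ => by compute_degree
    refine natDegree_mul_le.trans ?_
    have h3 := (natDegree_prod_le K _).trans (sum_le_card_nsmul K _ 2 h1)
    have h4 := (natDegree_prod_le I _).trans (sum_le_card_nsmul I _ 2 h2)
    simp only [smul_eq_mul] at h3 h4
    omega
  · simp [joinNum, ffNum, eval_prod]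

variable [DecidableEq ι]

/-- The summand of the decomposition `S = I ⊔ (S \ I)`, with weight `w` for each element of `I`
and `u` for each element of `S \ I`. -/
noncomputable def splitTerm (ω w u : ℂ) (x : ι → ℂ) (S I : Finset ι) : ℂ :=
  w ^ #I * u ^ #(S \ I) * ∏ i ∈ I, ∏ j ∈ S \ I, ff ω (x i / x j)

/-- The sum over all decompositions of `S`, with independent weights for the two parts. -/
noncomputable def splitSum (ω w u : ℂ) (x : ι → ℂ) (S : Finset ι) : ℂ :=
  ∑ I ∈ S.powerset, splitTerm ω w u x S I

lemma splitTerm_insert_right (ω w u : ℂ) (x : ι → ℂ) {S I : Finset ι} {k : ι} (hk : k ∉ S)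
    (hI : I ⊆ S) :
    splitTerm ω w u x (insert k S) I =
      splitTerm ω w u x S I * (u * ∏ i ∈ I, ff ω (x i / x k)) := by
  have hkI : k ∉ I := fun h => hk (hI h)
  have hkS : k ∉ S \ I := fun h => hk (mem_sdiff.1 h).1
  simp only [splitTerm, insert_sdiff_of_notMem _ hkI, card_insert_of_notMem hkS,
    prod_insert hkS, prod_mul_distrib]
  ring

lemma splitTerm_insert_left (ω w u : ℂ) (x : ι → ℂ) {S I : Finset ι} {k : ι} (hk : k ∉ S)
    (hI : I ⊆ S) :
    splitTerm ω w u x (insert k S) (insert k I) =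
      splitTerm ω w u x S I * (w * ∏ j ∈ S \ I, ff ω (x k / x j)) := by
  have hkI : k ∉ I := fun h => hk (hI h)
  have hs : insert k S \ insert k I = S \ I := by
    rw [insert_sdiff_of_mem _ (mem_insert_self k I), sdiff_insert_of_notMem hk]
  simp only [splitTerm, hs, card_insert_of_notMem hkI, prod_insert hkI]
  ring

/-- The numerator of `splitSum` as a function of an added entry `s`. -/
noncomputable def splitNum (ω w u : ℂ) (x : ι → ℂ) (S : Finset ι) (s : ℂ) : ℂ :=
  ∑ I ∈ S.powerset, splitTerm ω w u x S I *
    (u * joinNum ω (-s) x (S \ I) I + w * joinNum ω s x I (S \ I))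

lemma splitSum_insert_mul {ω : ℂ} (hω : ω ≠ 0) (w u : ℂ) (x : ι → ℂ) {S : Finset ι} {k : ι}
    (hk : k ∉ S) (hk0 : x k ≠ 0) (h0 : ∀ j ∈ S, x j ≠ 0)
    (hd : ∀ j ∈ S, x k ^ 2 - x j ^ 2 ≠ 0) :
    splitSum ω w u x (insert k S) * ∏ j ∈ S, (x k ^ 2 - x j ^ 2) =
      splitNum ω w u x S (x k) := by
  rw [splitSum, sum_powerset_insert hk, ← sum_add_distrib, sum_mul, splitNum]
  refine sum_congr rfl fun I hI => ?_
  rw [mem_powerset] at hI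
  have hK : S \ I ⊆ S := sdiff_subset
  have e1 : joinNum ω (-x k) x (S \ I) I =
      (∏ i ∈ I, ff ω (x i / x k)) * ∏ j ∈ S, (x k ^ 2 - x j ^ 2) := by
    rw [← prod_sdiff hI, joinNum, mul_left_comm, ← prod_mul_distrib, mul_comm]
    simp only [neg_sq]
    congr 1
    exact prod_congr rfl fun i hi => (ff_div_swap_mul hω hk0 (hd i (hI hi))).symm
  have e2 : joinNum ω (x k) x I (S \ I) =
      (∏ j ∈ S \ I, ff ω (x k / x j)) * ∏ j ∈ S, (x k ^ 2 - x j ^ 2) := by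
    rw [← prod_sdiff hI, joinNum, ← mul_assoc, ← prod_mul_distrib]
    congr 1
    exact prod_congr rfl fun j hj => (ff_div_mul ω (h0 j (hK hj)) (hd j (hK hj))).symm
  rw [splitTerm_insert_right ω w u x hk hI, splitTerm_insert_left ω w u x hk hI, e1, e2]
  ring

lemma splitNum_zero {ω : ℂ} (hω : ω ≠ 0) (w u : ℂ) (x : ι → ℂ) (S : Finset ι) :
    splitNum ω w u x S 0 = (w + u) * (∏ j ∈ S, -x j ^ 2) * splitSum ω w u x S := by
  rw [splitNum, splitSum, mul_sum]
  refine sum_congr rfl fun I hI => ?_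
  have h : ∀ y, ffNum ω 0 y = -y ^ 2 := fun y => by
    rw [ffNum]; field_simp; ring
  rw [← prod_sdiff (mem_powerset.1 hI)]
  simp only [joinNum, neg_zero, h, ne_eq, OfNat.ofNat_ne_zero, not_false_eq_true, zero_pow,
    zero_sub]
  ring

/-- At `s = ± x k` only the terms separating `s` from `k` survive. -/
lemma splitNum_insert_of_sq_eq {ω : ℂ} (hω : ω ≠ 0) (w u : ℂ) (x : ι → ℂ) {S : Finset ι} {k : ι}
    (hk : k ∉ S) (hk0 : x k ≠ 0) (h0 : ∀ j ∈ S, x j ≠ 0)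
    (hd : ∀ j ∈ S, x k ^ 2 - x j ^ 2 ≠ 0) {s : ℂ} (hs : s ^ 2 = x k ^ 2) :
    splitNum ω w u x (insert k S) s = ∑ I ∈ S.powerset, w * u * splitTerm ω w u x S I *
      (ffNum ω s (x k) * ((∏ j ∈ S \ I, ffNum ω s (x j)) * ∏ i ∈ I, ffNum ω (-x k) (x i)) +
      ffNum ω (-s) (x k) *
        ((∏ j ∈ S \ I, ffNum ω (x k) (x j)) * ∏ i ∈ I, ffNum ω (-s) (x i))) := by
  rw [splitNum, sum_powerset_insert hk, ← sum_add_distrib]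
  refine sum_congr rfl fun I hI => ?_
  rw [mem_powerset] at hI
  have hkI : k ∉ I := fun h => hk (hI h)
  have hkS : k ∉ S \ I := fun h => hk (mem_sdiff.1 h).1
  have hK : S \ I ⊆ S := sdiff_subset
  have hsd : insert k S \ insert k I = S \ I := by
    rw [insert_sdiff_of_mem _ (mem_insert_self k I), sdiff_insert_of_notMem hk]
  have e1 : ∏ i ∈ I, ffNum ω (-x k) (x i) =
      (∏ i ∈ I, ff ω (x i / x k)) * ∏ i ∈ I, (x k ^ 2 - x i ^ 2) := by
    rw [← prod_mul_distrib]
    exact prod_congr rfl fun i hi => (ff_div_swap_mul hω hk0 (hd i (hI hi))).symm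
  have e2 : ∏ j ∈ S \ I, ffNum ω (x k) (x j) =
      (∏ j ∈ S \ I, ff ω (x k / x j)) * ∏ j ∈ S \ I, (x k ^ 2 - x j ^ 2) := by
    rw [← prod_mul_distrib]
    exact prod_congr rfl fun j hj => (ff_div_mul ω (h0 j (hK hj)) (hd j (hK hj))).symm
  rw [splitTerm_insert_right ω w u x hk hI, splitTerm_insert_left ω w u x hk hI, e1, e2, hsd,
    insert_sdiff_of_notMem _ hkI]
  simp only [joinNum, prod_insert hkI, prod_insert hkS, neg_sq, hs, sub_self]
  ring

lemma splitNum_insert_self {ω : ℂ} (hω : ω ≠ 0) (w u : ℂ) (x : ι → ℂ) {S : Finset ι} {k : ι}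
    (hk : k ∉ S) (hk0 : x k ≠ 0) (h0 : ∀ j ∈ S, x j ≠ 0)
    (hd : ∀ j ∈ S, x k ^ 2 - x j ^ 2 ≠ 0) :
    splitNum ω w u x (insert k S) (x k) = 0 := by
  rw [splitNum_insert_of_sq_eq hω w u x hk hk0 h0 hd rfl]
  refine sum_eq_zero fun I _ => ?_
  rw [ffNum_swap hω (x k) (x k)]
  ring

lemma splitNum_insert_neg {ω : ℂ} (hω : ω ≠ 0) (w u : ℂ) (x : ι → ℂ) {S : Finset ι} {k : ι}
    (hk : k ∉ S) (hk0 : x k ≠ 0) (h0 : ∀ j ∈ S, x j ≠ 0)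
    (hd : ∀ j ∈ S, x k ^ 2 - x j ^ 2 ≠ 0) :
    splitNum ω w u x (insert k S) (-x k) = w * u * splitSum ω w u x S *
      (ffNum ω (-x k) (x k) * ∏ j ∈ S, ffNum ω (-x k) (x j) +
      ffNum ω (x k) (x k) * ∏ j ∈ S, ffNum ω (x k) (x j)) := by
  rw [splitNum_insert_of_sq_eq hω w u x hk hk0 h0 hd (neg_sq _), splitSum, mul_sum, sum_mul]
  refine sum_congr rfl fun I hI => ?_
  rw [neg_neg, prod_sdiff (mem_powerset.1 hI), prod_sdiff (mem_powerset.1 hI)]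

open Polynomial in
lemma exists_polynomial_splitNum (ω w u : ℂ) (x : ι → ℂ) (S : Finset ι) :
    ∃ p : ℂ[X], p.natDegree ≤ 2 * #S ∧ ∀ s, p.eval s = splitNum ω w u x S s := by
  choose p hp he using fun I : Finset ι => exists_polynomial_joinNum ω (-1) x (S \ I) I
  choose q hq hf using fun I : Finset ι => exists_polynomial_joinNum ω 1 x I (S \ I)
  refine ⟨∑ I ∈ S.powerset, C (splitTerm ω w u x S I) * (C u * p I + C w * q I), ?_,
    fun s => ?_⟩
  · refine natDegree_sum_le_of_forall_le _ _ fun I hI => ?_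
    have hc := card_sdiff_add_card_eq_card (mem_powerset.1 hI)
    refine (natDegree_C_mul_le _ _).trans (natDegree_add_le_of_degree_le ?_ ?_)
    · exact (natDegree_C_mul_le _ _).trans ((hp I).trans (by omega))
    · exact (natDegree_C_mul_le _ _).trans ((hq I).trans (by omega))
  · simp [splitNum, eval_finsetSum, he, hf]

lemma card_zero_insert_image_union_neg {x : ι → ℂ} {S : Finset ι} (h0 : ∀ i ∈ S, x i ≠ 0)
    (hd : ∀ i ∈ S, ∀ j ∈ S, i ≠ j → x i ^ 2 - x j ^ 2 ≠ 0) :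
    #(insert 0 (S.image x ∪ S.image fun i => -x i)) = 2 * #S + 1 := by
  have hinj : Set.InjOn x S := fun i hi j hj hij => by
    by_contra hne
    exact hd i hi j hj hne (by rw [hij, sub_self])
  have hdisj : Disjoint (S.image x) (S.image fun i => -x i) := by
    rw [disjoint_left]
    intro y hy hy'
    obtain ⟨i, hi, rfl⟩ := mem_image.1 hy
    obtain ⟨j, hj, hij⟩ := mem_image.1 hy'
    by_cases hne : i = j
    · subst hne
      exact h0 i hi (neg_eq_self.1 hij)
    · exact hd i hi j hj hne (by rw [← hij]; ring)
  have hz : (0 : ℂ) ∉ S.image x ∪ S.image fun i => -x i := by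
    simp only [mem_union, mem_image, neg_eq_zero, or_self, not_exists, not_and]
    exact h0
  rw [card_insert_of_notMem hz, card_union_of_disjoint hdisj, card_image_of_injOn hinj,
    card_image_of_injOn fun i hi j hj hij => hinj hi hj (neg_injective hij), two_mul]

/-- The sum over decompositions is symmetric in the weights of the two parts. -/
theorem splitSum_comm {ω : ℂ} (hω : ω ≠ 0) (w u : ℂ) (x : ι → ℂ) (S : Finset ι)
    (h0 : ∀ i ∈ S, x i ≠ 0) (hd : ∀ i ∈ S, ∀ j ∈ S, i ≠ j → x i ^ 2 - x j ^ 2 ≠ 0) :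
    splitSum ω w u x S = splitSum ω u w x S := by
  induction S using Finset.strongInduction with
  | H S ih =>
  have ih' : ∀ R, R ⊂ S → splitSum ω w u x R = splitSum ω u w x R := fun R hR =>
    ih R hR (fun i hi => h0 i (hR.1 hi)) fun i hi j hj => hd i (hR.1 hi) j (hR.1 hj)
  obtain rfl | ⟨k, hkS⟩ := S.eq_empty_or_nonempty
  · simp [splitSum, splitTerm]
  obtain ⟨R, hk, rfl⟩ : ∃ R, k ∉ R ∧ insert k R = S :=
    ⟨S.erase k, notMem_erase k S, insert_erase hkS⟩
  have hRS : R ⊂ insert k R := ssubset_insert hk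
  have h0R : ∀ i ∈ R, x i ≠ 0 := fun i hi => h0 i (hRS.1 hi)
  have hdR : ∀ i ∈ R, ∀ j ∈ R, i ≠ j → x i ^ 2 - x j ^ 2 ≠ 0 := fun i hi j hj =>
    hd i (hRS.1 hi) j (hRS.1 hj)
  have hdk : ∀ j ∈ R, x k ^ 2 - x j ^ 2 ≠ 0 := fun j hj =>
    hd k hkS j (hRS.1 hj) fun h => hk (h ▸ hj)
  obtain ⟨p, hp, hpe⟩ := exists_polynomial_splitNum ω w u x R
  obtain ⟨q, hq, hqe⟩ := exists_polynomial_splitNum ω u w x R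
  have hpq : p - q = 0 := by
    refine Polynomial.eq_zero_of_natDegree_lt_card_of_eval_eq_zero' _
      (insert 0 (R.image x ∪ R.image fun i => -x i)) (fun s hs => ?_) ?_
    · rw [Polynomial.eval_sub, hpe, hqe, sub_eq_zero]
      have key : ∀ m ∈ R, splitNum ω w u x R (x m) = splitNum ω u w x R (x m) ∧
          splitNum ω w u x R (-x m) = splitNum ω u w x R (-x m) := by
        intro m hm
        obtain ⟨Q, hmQ, rfl⟩ : ∃ Q, m ∉ Q ∧ insert m Q = R :=
          ⟨R.erase m, notMem_erase m R, insert_erase hm⟩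
        have hQ : Q ⊂ insert m Q := ssubset_insert hmQ
        have h0Q : ∀ i ∈ Q, x i ≠ 0 := fun i hi => h0R i (hQ.1 hi)
        have hdm : ∀ j ∈ Q, x m ^ 2 - x j ^ 2 ≠ 0 := fun j hj =>
          hdR m hm j (hQ.1 hj) fun h => hmQ (h ▸ hj)
        constructor
        · rw [splitNum_insert_self hω w u x hmQ (h0R m hm) h0Q hdm,
            splitNum_insert_self hω u w x hmQ (h0R m hm) h0Q hdm]
        · rw [splitNum_insert_neg hω w u x hmQ (h0R m hm) h0Q hdm,
            splitNum_insert_neg hω u w x hmQ (h0R m hm) h0Q hdm, ih' Q (hQ.trans hRS),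
            mul_comm w u]
      simp only [mem_insert, mem_union, mem_image] at hs
      obtain rfl | ⟨m, hm, rfl⟩ | ⟨m, hm, rfl⟩ := hs
      · rw [splitNum_zero hω, splitNum_zero hω, ih' R hRS, add_comm w u]
      · exact (key m hm).1
      · exact (key m hm).2
    · rw [card_zero_insert_image_union_neg h0R hdR]
      exact Nat.lt_succ_of_le (Polynomial.natDegree_sub_le_of_le hp hq |>.trans (max_self _).le)
  refine mul_right_cancel₀ (prod_ne_zero_iff.2 hdk) ?_
  rw [splitSum_insert_mul hω w u x hk (h0 k hkS) h0R hdk,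
    splitSum_insert_mul hω u w x hk (h0 k hkS) h0R hdk, ← hpe, ← hqe, sub_eq_zero.1 hpq]

end Configurations

lemma phase_eq_pow_mul_pow (a : ℂ) {N c d : ℕ} (h : d + c = N) :
    phase a N c =
      Complex.exp (Complex.I * Real.pi * a) ^ c * Complex.exp (Complex.I * Real.pi * -a) ^ d := by
  rw [phase, ← Complex.exp_nat_mul, ← Complex.exp_nat_mul, ← Complex.exp_add, ← h]
  congr 1
  push_cast
  ring

lemma Jexp_eq_splitSum (ω a : ℂ) {N : ℕ} (X : Fin N → ℂ) :
    Jexp ω a X = splitSum ω (Complex.exp (Complex.I * Real.pi * a))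
      (Complex.exp (Complex.I * Real.pi * -a)) X univ := by
  rw [Jexp, splitSum, powerset_univ]
  refine sum_congr rfl fun I _ => ?_
  rw [splitTerm, ← compl_eq_univ_sdiff,
    phase_eq_pow_mul_pow a (by rw [card_compl_add_card, Fintype.card_fin])]

/-- reflection property for exponential operators: for every `a`, `N ≥ 0`, and
admissible `X`, `J_{N,a}(X) = J_{N,−a}(X)` (the identity `f_a = f_{−a}` between the breather
form factors of `e^{iαφ}` and `e^{i(2α_0−α)φ}`). -/
theorem stmt8 (ω : ℂ) (hω : ω ≠ 0 ∧ ω ≠ 1 ∧ ω ≠ -1) (a : ℂ)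
    (N : ℕ) (X : Fin N → ℂ) (hadm : Admissible X) :
    Jexp ω a X = Jexp ω (-a) X := by
  rw [Jexp_eq_splitSum, Jexp_eq_splitSum, neg_neg]
  refine splitSum_comm hω.1 _ _ X univ (fun i _ => hadm.1 i) fun i _ j _ hij h => ?_
  rcases sq_eq_sq_iff_eq_or_eq_neg.1 (sub_eq_zero.1 h) with h | h
  · exact (hadm.2 i j hij).1 h
  · exact (hadm.2 i j hij).2 h
end

section
/- Subleading large-rapidity asymptotics at level two: let a ∈ ℂ with cos πa ≠ 0, N ≥ 1, and let (x_1,…,x_{N−1}) be admissible with all x_i nonzero. Then, as the real parameter x → +∞, x^{−1} · ( J^{(2)}_{N,a}(x_1,…,x_{N−1}, x) − i·tan πa · J^{(1,1)}_{N,a}(x_1,…,x_{N−1}, x) ) converges to 2i · (sin πp − sin 2πa)/cos πa · J^{(1)}_{N−1,a}(x_1,…,x_{N−1}), where J^{(2)}, J^{(1,1)}, J^{(1)} are the J functions of the partitions (2), (1,1), (1) respectively, tan πa = sin πa / cos πa, cos πa = (e^{iπa}+e^{−iπa})/2, sin πa = (e^{iπa}−e^{−iπa})/(2i), and sin 2πa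 = 2 sin πa cos πa. -/
open Finset Filter Complex

noncomputable def cosπ (a : ℂ) : ℂ :=
  (Complex.exp (Complex.I * (Real.pi : ℂ) * a)
    + Complex.exp (-(Complex.I * (Real.pi : ℂ) * a))) / 2

noncomputable def sinπ (a : ℂ) : ℂ :=
  (Complex.exp (Complex.I * (Real.pi : ℂ) * a)
    - Complex.exp (-(Complex.I * (Real.pi : ℂ) * a))) / (2 * Complex.I)

/-- Multiplicities of the partition `(2)`. -/
def k2 : ℕ → ℕ := fun m => if m = 2 then 1 else 0
/-- Multiplicities of the partition `(1,1)`. -/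
def k11 : ℕ → ℕ := fun m => if m = 1 then 2 else 0
/-- Multiplicities of the partition `(1)`. -/
def k1 : ℕ → ℕ := fun m => if m = 1 then 1 else 0

section Splitting

/-- A sum over the subsets of `Fin (M + 1)`, split according to membership of the last index. -/
theorem sum_finset_fin_succ {β : Type*} [AddCommMonoid β] {M : ℕ}
    (g : Finset (Fin (M + 1)) → β) :
    ∑ I, g I = ∑ I : Finset (Fin M),
      (g (I.map Fin.castSuccEmb) + g (insert (Fin.last M) (I.map Fin.castSuccEmb))) := by
  have hlast : Fin.last M ∉ (univ : Finset (Fin M)).map Fin.castSuccEmb := by simp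
  have huniv : (univ : Finset (Finset (Fin (M + 1)))) =
      (insert (Fin.last M) ((univ : Finset (Fin M)).map Fin.castSuccEmb)).powerset := by
    rw [← powerset_univ, Fin.univ_castSuccEmb, cons_eq_insert]
  have hmap (h : Finset (Fin (M + 1)) → β) :
      ∑ I ∈ ((univ : Finset (Fin M)).map Fin.castSuccEmb).powerset, h I =
        ∑ I : Finset (Fin M), h (I.map Fin.castSuccEmb) := by
    symm
    refine sum_bij (fun I _ => I.map Fin.castSuccEmb) ?_ ?_ ?_ ?_
    · intro I _
      exact mem_powerset.2 (map_subset_map.2 (subset_univ I))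
    · intro I _ K _ h
      exact map_injective _ h
    · intro K hK
      obtain ⟨I, -, rfl⟩ := subset_map_iff.1 (mem_powerset.1 hK)
      exact ⟨I, mem_univ _, rfl⟩
    · intros
      rfl
  rw [huniv, sum_powerset_insert hlast, hmap, hmap, ← sum_add_distrib]

theorem compl_map_castSuccEmb {M : ℕ} (I : Finset (Fin M)) :
    (I.map Fin.castSuccEmb)ᶜ = insert (Fin.last M) (Iᶜ.map Fin.castSuccEmb) := by
  ext i
  induction i using Fin.lastCases <;> simp

theorem compl_insert_last_map_castSuccEmb {M : ℕ} (I : Finset (Fin M)) :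
    (insert (Fin.last M) (I.map Fin.castSuccEmb))ᶜ = Iᶜ.map Fin.castSuccEmb := by
  ext i
  induction i using Fin.lastCases <;> simp

theorem pS_snoc_map (m : ℤ) {M : ℕ} (X : Fin M → ℂ) (x : ℂ) (I : Finset (Fin M)) :
    pS m (Fin.snoc X x : Fin (M + 1) → ℂ) (I.map Fin.castSuccEmb) = pS m X I := by
  simp [pS]

theorem pS_snoc_insert_last (m : ℤ) {M : ℕ} (X : Fin M → ℂ) (x : ℂ) (I : Finset (Fin M)) :
    pS m (Fin.snoc X x : Fin (M + 1) → ℂ) (insert (Fin.last M) (I.map Fin.castSuccEmb)) =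
      x ^ m + pS m X I := by
  rw [← pS_snoc_map m X x I, pS, sum_insert (by simp), Fin.snoc_last, pS]

theorem phase_succ (a : ℂ) (M c : ℕ) :
    phase a (M + 1) c = exp (-(I * (Real.pi : ℂ) * a)) * phase a M c := by
  rw [phase, phase, ← exp_add]
  congr 1
  push_cast
  ring

theorem phase_succ_succ (a : ℂ) (M c : ℕ) :
    phase a (M + 1) (c + 1) = exp (I * (Real.pi : ℂ) * a) * phase a M c := by
  rw [phase, phase, ← exp_add]
  congr 1
  push_cast
  ring

/-- `J` of a tuple with one more entry `x`, as a sum over the splittings of the other entries. -/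
theorem J_snoc (ω : ℂ) (k : ℕ → ℕ) (s : ℕ) (a : ℂ) {M : ℕ} (X : Fin M → ℂ) (x : ℂ) :
    J ω k s a (Fin.snoc X x : Fin (M + 1) → ℂ) = ∑ K : Finset (Fin M),
      phase a M K.card * (∏ i ∈ K, ∏ j ∈ Kᶜ, ff ω (X i / X j)) *
        (exp (-(I * (Real.pi : ℂ) * a)) *
            (∏ m ∈ Icc 1 s,
              (pS (m : ℤ) X K - (-1 : ℂ) ^ m * (x ^ m + pS (m : ℤ) X Kᶜ)) ^ k m) *
            (∏ i ∈ K, ff ω (X i / x)) +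
          exp (I * (Real.pi : ℂ) * a) *
            (∏ m ∈ Icc 1 s,
              (x ^ m + pS (m : ℤ) X K - (-1 : ℂ) ^ m * pS (m : ℤ) X Kᶜ) ^ k m) *
            (∏ j ∈ Kᶜ, ff ω (x / X j))) := by
  rw [J, sum_finset_fin_succ]
  refine sum_congr rfl fun K _ => ?_
  have hK : Fin.last M ∉ K.map Fin.castSuccEmb := by simp
  have hKc : Fin.last M ∉ Kᶜ.map Fin.castSuccEmb := by simp
  rw [compl_insert_last_map_castSuccEmb, compl_map_castSuccEmb, card_insert_of_notMem hK,
    card_map, phase_succ, phase_succ_succ, prod_insert hK]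
  simp only [Ph, pS_snoc_insert_last, pS_snoc_map, prod_insert hKc, prod_map, Fin.coe_castSuccEmb,
    Fin.snoc_castSucc, Fin.snoc_last, prod_mul_distrib, zpow_natCast]
  ring

end Splitting

section Asymptotics

theorem tendsto_ofReal_inv_atTop : Tendsto (fun x : ℝ => (x : ℂ)⁻¹) atTop (nhds 0) := by
  simpa [Function.comp_def] using (continuous_ofReal.tendsto 0).comp tendsto_inv_atTop_zero

/-- If `x (g x - 1)` converges then `g` tends to `1`. -/
theorem tendsto_one_of_tendsto_mul_sub_one {g : ℝ → ℂ} {c : ℂ}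
    (h : Tendsto (fun x : ℝ => (x : ℂ) * (g x - 1)) atTop (nhds c)) :
    Tendsto g atTop (nhds 1) := by
  have h1 := (tendsto_ofReal_inv_atTop.mul h).add_const 1
  rw [zero_mul, zero_add] at h1
  refine h1.congr' ?_
  filter_upwards [eventually_gt_atTop 0] with x hx
  have : (x : ℂ) ≠ 0 := ofReal_ne_zero.2 hx.ne'
  field_simp
  ring

/-- First order expansions `1 + c i / x + o(1 / x)` multiply. -/
theorem tendsto_mul_prod_sub_one {ι : Type*} (A : Finset ι) {g : ι → ℝ → ℂ} {c : ι → ℂ}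
    (h : ∀ i ∈ A, Tendsto (fun x : ℝ => (x : ℂ) * (g i x - 1)) atTop (nhds (c i))) :
    Tendsto (fun x : ℝ => (x : ℂ) * (∏ i ∈ A, g i x - 1)) atTop (nhds (∑ i ∈ A, c i)) := by
  classical
  induction A using Finset.induction_on with
  | empty => simp
  | insert i A hi ih =>
    have hA := ih fun j hj => h j (mem_insert_of_mem hj)
    have hlim := ((h i (mem_insert_self i A)).mul (tendsto_one_of_tendsto_mul_sub_one hA)).add hA
    rw [mul_one] at hlim
    simp only [prod_insert hi, sum_insert hi]
    exact hlim.congr fun x => by ring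

theorem eventually_sq_ne_sq (y : ℂ) :
    ∀ᶠ x : ℝ in atTop, (x : ℂ) ≠ 0 ∧ (x : ℂ) ^ 2 - y ^ 2 ≠ 0 := by
  filter_upwards [eventually_gt_atTop ‖y‖] with x hx
  have hx0 : 0 < x := (norm_nonneg y).trans_lt hx
  refine ⟨ofReal_ne_zero.2 hx0.ne', fun h => ?_⟩
  have h2 := congrArg norm (sub_eq_zero.1 h)
  rw [norm_pow, norm_pow, norm_real, Real.norm_of_nonneg hx0.le] at h2
  nlinarith [norm_nonneg y]

theorem tendsto_mul_div_sq_sub_sq (d y : ℂ) :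
    Tendsto (fun x : ℝ => d * y * (x : ℂ) ^ 2 / ((x : ℂ) ^ 2 - y ^ 2)) atTop (nhds (d * y)) := by
  have hden : Tendsto (fun x : ℝ => 1 - y ^ 2 * (x : ℂ)⁻¹ ^ 2) atTop (nhds 1) := by
    simpa using ((tendsto_ofReal_inv_atTop.pow 2).const_mul (y ^ 2)).const_sub 1
  have hlim := (tendsto_const_nhds (x := d * y)).div hden one_ne_zero
  rw [div_one] at hlim
  refine hlim.congr' ?_
  filter_upwards [eventually_sq_ne_sq y] with x hx
  obtain ⟨hx0, hxy⟩ := hx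
  have : 1 - y ^ 2 * (x : ℂ)⁻¹ ^ 2 = ((x : ℂ) ^ 2 - y ^ 2) / (x : ℂ) ^ 2 := by field_simp
  rw [Pi.div_apply, this, div_div_eq_mul_div]

theorem ff_sub_one {ω z : ℂ} (hω : ω ≠ 0) (hz : z ^ 2 - 1 ≠ 0) :
    ff ω z - 1 = (ω - ω⁻¹) * z / (z ^ 2 - 1) := by
  rw [ff, div_sub_one hz]
  congr 1
  linear_combination -mul_inv_cancel₀ hω

theorem tendsto_mul_ff_div_const_sub_one {ω y : ℂ} (hω : ω ≠ 0) (hy : y ≠ 0) :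
    Tendsto (fun x : ℝ => (x : ℂ) * (ff ω (x / y) - 1)) atTop (nhds ((ω - ω⁻¹) * y)) := by
  refine (tendsto_mul_div_sq_sub_sq (ω - ω⁻¹) y).congr' ?_
  filter_upwards [eventually_sq_ne_sq y] with x hx
  obtain ⟨hx0, hxy⟩ := hx
  have hz : ((x : ℂ) / y) ^ 2 - 1 = ((x : ℂ) ^ 2 - y ^ 2) / y ^ 2 := by field_simp
  rw [ff_sub_one hω (by rw [hz]; exact div_ne_zero hxy (pow_ne_zero 2 hy)), hz]
  generalize ω - ω⁻¹ = d
  field_simp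

theorem tendsto_mul_ff_const_div_sub_one {ω : ℂ} (hω : ω ≠ 0) (y : ℂ) :
    Tendsto (fun x : ℝ => (x : ℂ) * (ff ω (y / x) - 1)) atTop (nhds (-(ω - ω⁻¹) * y)) := by
  refine (tendsto_mul_div_sq_sub_sq (-(ω - ω⁻¹)) y).congr' ?_
  filter_upwards [eventually_sq_ne_sq y] with x hx
  obtain ⟨hx0, hxy⟩ := hx
  have hz : (y / (x : ℂ)) ^ 2 - 1 = -((x : ℂ) ^ 2 - y ^ 2) / (x : ℂ) ^ 2 := by
    field_simp
    ring
  rw [ff_sub_one hω (by rw [hz]; exact div_ne_zero (neg_ne_zero.2 hxy) (pow_ne_zero 2 hx0)), hz]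
  generalize ω - ω⁻¹ = d
  field_simp

/-- The contribution of a single splitting: here `E = e^{iπa}`, `E' = e^{-iπa}`, `t = i tan πa`,
`G` and `H` are the products of the factors involving `x`, and `A`, `B` are the power sums `S_1`
of the two parts. -/
theorem tendsto_splitting_term {E E' t d A B D : ℂ} {G H : ℝ → ℂ} (hE : E * E' = 1)
    (ht : t * (E + E') = E - E') (hne : E + E' ≠ 0)
    (hG : Tendsto (fun x : ℝ => (x : ℂ) * (G x - 1)) atTop (nhds (d * B)))
    (hH : Tendsto (fun x : ℝ => (x : ℂ) * (H x - 1)) atTop (nhds (-d * A))) :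
    Tendsto (fun x : ℝ => (x : ℂ)⁻¹ *
        ((E' * (D - (x : ℂ) ^ 2) * H x + E * ((x : ℂ) ^ 2 + D) * G x) -
          t * (E' * (x + (A + B)) ^ 2 * H x + E * (x + (A + B)) ^ 2 * G x)))
      atTop (nhds ((2 * d / (E + E') - 2 * (E - E')) * (A + B))) := by
  have hG1 := tendsto_one_of_tendsto_mul_sub_one hG
  have hH1 := tendsto_one_of_tendsto_mul_sub_one hH
  have hsum := (hG1.const_mul E).add (hH1.const_mul E')
  have hlim := (((tendsto_ofReal_inv_atTop.mul hsum).const_mul (D - t * (A + B) ^ 2)).add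
    ((hG.const_mul (E * (1 - t))).sub (hH.const_mul (E' * (1 + t))))).sub
      (hsum.const_mul (2 * t * (A + B)))
  have ht' : t = (E - E') / (E + E') := eq_div_of_mul_eq hne ht
  have hval : (D - t * (A + B) ^ 2) * (0 * (E * 1 + E' * 1)) +
      (E * (1 - t) * (d * B) - E' * (1 + t) * (-d * A)) -
        2 * t * (A + B) * (E * 1 + E' * 1) =
      (2 * d / (E + E') - 2 * (E - E')) * (A + B) := by
    have h1 : E * (1 - t) = 2 / (E + E') := by
      rw [ht']
      field_simp
      linear_combination 2 * hE
    have h2 : E' * (1 + t) = 2 / (E + E') := by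
      rw [ht']
      field_simp
      linear_combination 2 * hE
    rw [h1, h2]
    linear_combination -2 * (A + B) * ht
  rw [hval] at hlim
  refine hlim.congr' ?_
  filter_upwards [eventually_gt_atTop 0] with x hx
  have hx0 : (x : ℂ) ≠ 0 := ofReal_ne_zero.2 hx.ne'
  field_simp
  linear_combination (x : ℂ) ^ 2 * ht

end Asymptotics

/-- subleading large-rapidity asymptotics at level two: if `cos πa ≠ 0` and
`(x_1,…,x_{N−1})` is admissible, then as the real parameter `x → +∞`,
`x⁻¹·(J^{(2)}_{N,a}(x_1,…,x_{N−1},x) − i·tan πa·J^{(1,1)}_{N,a}(x_1,…,x_{N−1},x))`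
converges to `2i·(sin πp − sin 2πa)/cos πa · J^{(1)}_{N−1,a}(x_1,…,x_{N−1})`. -/
theorem stmt11 (ω : ℂ) (hω : ω ≠ 0 ∧ ω ≠ 1 ∧ ω ≠ -1) (a : ℂ) (hcos : cosπ a ≠ 0)
    (M : ℕ) (X : Fin M → ℂ) (hadm : Admissible X) :
    Filter.Tendsto
      (fun x : ℝ => ((x : ℂ))⁻¹ *
        (J ω k2 2 a (Fin.snoc X (x : ℂ)) -
          Complex.I * (sinπ a / cosπ a) * J ω k11 1 a (Fin.snoc X (x : ℂ))))
      Filter.atTop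
      (nhds (2 * Complex.I * (((ω - ω⁻¹) / (2 * Complex.I)) - 2 * sinπ a * cosπ a)
        / cosπ a * J ω k1 1 a X)) := by
  obtain ⟨hω0, -, -⟩ := hω
  set E := exp (I * (Real.pi : ℂ) * a) with hEdef
  set E' := exp (-(I * (Real.pi : ℂ) * a)) with hE'def
  have hE : E * E' = 1 := by rw [hEdef, hE'def, ← exp_add, add_neg_cancel, exp_zero]
  have hc : cosπ a = (E + E') / 2 := rfl
  have hs : sinπ a = (E - E') / (2 * I) := rfl
  have hne : E + E' ≠ 0 := fun h => hcos (by rw [hc, h, zero_div])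
  have ht : I * (sinπ a / cosπ a) * (E + E') = E - E' := by
    rw [hc, hs]
    field_simp
  have hconst : 2 * I * (((ω - ω⁻¹) / (2 * I)) - 2 * sinπ a * cosπ a) / cosπ a =
      2 * (ω - ω⁻¹) / (E + E') - 2 * (E - E') := by
    rw [hc, hs]
    generalize ω - ω⁻¹ = d
    field_simp
  rw [hconst]
  have hIcc : Icc 1 2 = ({1, 2} : Finset ℕ) := rfl
  have hterm (K : Finset (Fin M)) := (tendsto_splitting_term (A := pS 1 X K) (B := pS 1 X Kᶜ)
    (D := pS 2 X K - pS 2 X Kᶜ) (d := ω - ω⁻¹) hE ht hne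
    (by
      simpa [pS, mul_sum] using tendsto_mul_prod_sub_one Kᶜ fun j _ =>
        tendsto_mul_ff_div_const_sub_one hω0 (hadm.1 j))
    (by
      simpa only [pS, zpow_one, mul_sum] using tendsto_mul_prod_sub_one K fun i _ =>
        tendsto_mul_ff_const_div_sub_one hω0 (X i))).const_mul
      (phase a M K.card * ∏ i ∈ K, ∏ j ∈ Kᶜ, ff ω (X i / X j))
  have hlim := tendsto_finsetSum univ fun K _ => hterm K
  convert hlim using 2 with x
  · rw [J_snoc, J_snoc, mul_sum, ← sum_sub_distrib, mul_sum]
    refine sum_congr rfl fun K _ => ?_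
    simp [hIcc, k2, k11, ← hEdef, ← hE'def]
    ring
  · rw [J, mul_sum]
    refine sum_congr rfl fun K _ => ?_
    simp [Ph, k1]
    ring
end

section
/- Reflection relation for the level-(2,0) descendants: for every a ∈ ℂ with cos πa ≠ 0, every N ≥ 0, and every admissible tuple X = (x_1,…,x_N), (sin πp + sin 2πa) · ( J^{(2)}_{N,a}(X) − i·tan πa · J^{(1,1)}_{N,a}(X) ) = (sin πp − sin 2πa) · ( J^{(2)}_{N,−a}(X) + i·tan πa · J^{(1,1)}_{N,−a}(X) ), where J^{(2)} and J^{(1,1)} are the J functions of the partitions (2) and (1,1). Equivalently, the combination (sin πp − sin 2πa)^{−1}(J^{(2)}_{N,a}(X) − i tan πa · J^{(1,1)}_{N,a}(X)) is invariant under a → −a. -/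
open Finset Filter Complex

/-- The cross product `∏_{i∈A, j∈B} f(x_i/x_j)`. -/
noncomputable def crossProd {ι : Type*} (ω : ℂ) (x : ι → ℂ) (A B : Finset ι) : ℂ :=
  ∏ i ∈ A, ∏ j ∈ B, ff ω (x i / x j)

/-- The combination `(q + r) J^{(2)} - (q - r) J^{(1,1)}` over the index set `S`, where a splitting
`S = I ⊔ (S \ I)` has phase `q ^ #I * r ^ #(S \ I)`. -/
noncomputable def levelTwoSum {ι : Type*} [DecidableEq ι] (ω q r : ℂ) (S : Finset ι)
    (x : ι → ℂ) : ℂ :=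
  ∑ I ∈ S.powerset, q ^ #I * r ^ #(S \ I) *
    ((q + r) * (∑ i ∈ I, x i ^ 2 - ∑ j ∈ S \ I, x j ^ 2) - (q - r) * (∑ i ∈ S, x i) ^ 2) *
    crossProd ω x I (S \ I)

/-- The polynomial whose value at `y` is `∏_{k∈S} (y² - x_k²)` times the level-two sum of `S`
extended by one more entry `y`. -/
noncomputable def insertPoly {ι : Type*} [DecidableEq ι] (ω q r : ℂ) (S : Finset ι)
    (x : ι → ℂ) : Polynomial ℂ :=
  ∑ I ∈ S.powerset, Polynomial.C (q ^ #I * r ^ #(S \ I) * crossProd ω x I (S \ I)) *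
    (Polynomial.C q * (Polynomial.C (q + r) *
          (Polynomial.C (∑ i ∈ I, x i ^ 2 - ∑ j ∈ S \ I, x j ^ 2) + Polynomial.X ^ 2) -
          Polynomial.C (q - r) * (Polynomial.C (∑ i ∈ S, x i) + Polynomial.X) ^ 2) *
        ((∏ j ∈ S \ I, (Polynomial.X ^ 2 + Polynomial.C ((ω - ω⁻¹) * x j) * Polynomial.X -
            Polynomial.C (x j ^ 2))) *
          ∏ i ∈ I, (Polynomial.X ^ 2 - Polynomial.C (x i ^ 2))) +
      Polynomial.C r * (Polynomial.C (q + r) *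
          (Polynomial.C (∑ i ∈ I, x i ^ 2 - ∑ j ∈ S \ I, x j ^ 2) - Polynomial.X ^ 2) -
          Polynomial.C (q - r) * (Polynomial.C (∑ i ∈ S, x i) + Polynomial.X) ^ 2) *
        ((∏ i ∈ I, (Polynomial.X ^ 2 - Polynomial.C ((ω - ω⁻¹) * x i) * Polynomial.X -
            Polynomial.C (x i ^ 2))) *
          ∏ j ∈ S \ I, (Polynomial.X ^ 2 - Polynomial.C (x j ^ 2))))

/-- Admissibility of the entries `x i`, `i ∈ S`. -/
def AdmissibleOn {ι : Type*} (S : Finset ι) (x : ι → ℂ) : Prop :=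
  (∀ i ∈ S, x i ≠ 0) ∧ ∀ i ∈ S, ∀ j ∈ S, i ≠ j → x i ^ 2 ≠ x j ^ 2

section LevelTwo

variable {ι : Type*} {ω q r : ℂ} {S : Finset ι} {x : ι → ℂ}

lemma AdmissibleOn.mono {T : Finset ι} (h : AdmissibleOn S x) (hT : T ⊆ S) :
    AdmissibleOn T x :=
  ⟨fun i hi => h.1 i (hT hi), fun i hi j hj => h.2 i (hT hi) j (hT hj)⟩

lemma ff_div_mul_s12 (hω : ω ≠ 0) {u v : ℂ} (hv : v ≠ 0) (huv : u ^ 2 ≠ v ^ 2) :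
    ff ω (u / v) * (v ^ 2 - u ^ 2) = v ^ 2 - (ω - ω⁻¹) * u * v - u ^ 2 := by
  have h1 : (u / v) ^ 2 - 1 ≠ 0 := by
    rw [div_pow, sub_ne_zero, Ne, div_eq_one_iff_eq (pow_ne_zero 2 hv)]
    exact huv
  have h2 : v ^ 2 - u ^ 2 = -(v ^ 2) * ((u / v) ^ 2 - 1) := by
    field_simp
    ring
  rw [ff, h2, div_mul_eq_mul_div, div_eq_iff h1]
  field_simp
  ring

lemma prod_ff_right (hω : ω ≠ 0) (A : Finset ι) {v : ℂ} (hv : v ≠ 0)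
    (hA : ∀ i ∈ A, x i ^ 2 ≠ v ^ 2) :
    (∏ i ∈ A, ff ω (x i / v)) * ∏ i ∈ A, (v ^ 2 - x i ^ 2) =
      ∏ i ∈ A, (v ^ 2 - (ω - ω⁻¹) * x i * v - x i ^ 2) := by
  rw [← prod_mul_distrib]
  exact prod_congr rfl fun i hi => ff_div_mul_s12 hω hv (hA i hi)

lemma prod_ff_left (hω : ω ≠ 0) (A : Finset ι) {v : ℂ} (hA₀ : ∀ i ∈ A, x i ≠ 0)
    (hA : ∀ i ∈ A, x i ^ 2 ≠ v ^ 2) :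
    (∏ i ∈ A, ff ω (v / x i)) * ∏ i ∈ A, (v ^ 2 - x i ^ 2) =
      ∏ i ∈ A, (v ^ 2 + (ω - ω⁻¹) * x i * v - x i ^ 2) := by
  rw [← prod_mul_distrib]
  refine prod_congr rfl fun i hi => ?_
  linear_combination -ff_div_mul_s12 hω (hA₀ i hi) (hA i hi).symm

lemma crossProd_congr {x' : ι → ℂ} {A B : Finset ι} (hA : ∀ i ∈ A, x i = x' i)
    (hB : ∀ j ∈ B, x j = x' j) : crossProd ω x A B = crossProd ω x' A B :=
  prod_congr rfl fun i hi => prod_congr rfl fun j hj => by rw [hA i hi, hB j hj]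

variable [DecidableEq ι]

lemma crossProd_insert_left {n : ι} {A B : Finset ι} (hn : n ∉ A) :
    crossProd ω x (insert n A) B = (∏ j ∈ B, ff ω (x n / x j)) * crossProd ω x A B := by
  simp [crossProd, prod_insert hn]

lemma crossProd_insert_right {n : ι} {A B : Finset ι} (hn : n ∉ B) :
    crossProd ω x A (insert n B) = (∏ i ∈ A, ff ω (x i / x n)) * crossProd ω x A B := by
  simp [crossProd, prod_insert hn, prod_mul_distrib]

lemma sum_powerset_insert_sdiff {n : ι} (hn : n ∉ S) (g : Finset ι → Finset ι → ℂ) :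
    ∑ I ∈ (insert n S).powerset, g I (insert n S \ I) =
      ∑ I ∈ S.powerset, (g I (insert n (S \ I)) + g (insert n I) (S \ I)) := by
  rw [sum_powerset_insert hn, ← sum_add_distrib]
  refine sum_congr rfl fun I hI => ?_
  have hnI : n ∉ I := fun h => hn (mem_powerset.1 hI h)
  rw [insert_sdiff_of_notMem _ hnI, insert_sdiff_insert, sdiff_insert_of_notMem hn]

lemma eval_insertPoly (y : ℂ) : (insertPoly ω q r S x).eval y =
    ∑ I ∈ S.powerset, (q ^ #I * r ^ #(S \ I) * crossProd ω x I (S \ I)) *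
    (q * ((q + r) * ((∑ i ∈ I, x i ^ 2 - ∑ j ∈ S \ I, x j ^ 2) + y ^ 2) -
          (q - r) * ((∑ i ∈ S, x i) + y) ^ 2) *
        ((∏ j ∈ S \ I, (y ^ 2 + (ω - ω⁻¹) * x j * y - x j ^ 2)) * ∏ i ∈ I, (y ^ 2 - x i ^ 2)) +
      r * ((q + r) * ((∑ i ∈ I, x i ^ 2 - ∑ j ∈ S \ I, x j ^ 2) - y ^ 2) -
          (q - r) * ((∑ i ∈ S, x i) + y) ^ 2) *
        ((∏ i ∈ I, (y ^ 2 - (ω - ω⁻¹) * x i * y - x i ^ 2)) *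
          ∏ j ∈ S \ I, (y ^ 2 - x j ^ 2))) := by
  simp only [insertPoly, Polynomial.eval_finsetSum, Polynomial.eval_mul, Polynomial.eval_add,
    Polynomial.eval_sub, Polynomial.eval_prod, Polynomial.eval_pow, Polynomial.eval_C,
    Polynomial.eval_X]

lemma levelTwoSum_congr {x' : ι → ℂ} (h : ∀ i ∈ S, x i = x' i) :
    levelTwoSum ω q r S x = levelTwoSum ω q r S x' := by
  refine sum_congr rfl fun I hI => ?_
  have hI' : ∀ i ∈ I, x i = x' i := fun i hi => h i (mem_powerset.1 hI hi)
  have hc : ∀ i ∈ S \ I, x i = x' i := fun i hi => h i (mem_sdiff.1 hi).1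
  have sum_eq {A : Finset ι} (hA : ∀ i ∈ A, x i = x' i) (g : ℂ → ℂ) :
      ∑ i ∈ A, g (x i) = ∑ i ∈ A, g (x' i) := sum_congr rfl fun i hi => by rw [hA i hi]
  rw [crossProd_congr hI' hc, sum_eq h (fun t => t), sum_eq hI' (fun t => t ^ 2),
    sum_eq hc (fun t => t ^ 2)]

lemma insertPoly_congr {x' : ι → ℂ} (h : ∀ i ∈ S, x i = x' i) :
    insertPoly ω q r S x = insertPoly ω q r S x' := by
  refine Polynomial.funext fun y => ?_
  rw [eval_insertPoly, eval_insertPoly]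
  refine sum_congr rfl fun I hI => ?_
  have hI' : ∀ i ∈ I, x i = x' i := fun i hi => h i (mem_powerset.1 hI hi)
  have hc : ∀ i ∈ S \ I, x i = x' i := fun i hi => h i (mem_sdiff.1 hi).1
  have sum_eq {A : Finset ι} (hA : ∀ i ∈ A, x i = x' i) (g : ℂ → ℂ) :
      ∑ i ∈ A, g (x i) = ∑ i ∈ A, g (x' i) := sum_congr rfl fun i hi => by rw [hA i hi]
  have prod_eq {A : Finset ι} (hA : ∀ i ∈ A, x i = x' i) (g : ℂ → ℂ) :
      ∏ i ∈ A, g (x i) = ∏ i ∈ A, g (x' i) := prod_congr rfl fun i hi => by rw [hA i hi]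
  rw [crossProd_congr hI' hc, sum_eq h (fun t => t), sum_eq hI' (fun t => t ^ 2),
    sum_eq hc (fun t => t ^ 2), prod_eq hI' (fun t => y ^ 2 - t ^ 2),
    prod_eq hc (fun t => y ^ 2 - t ^ 2),
    prod_eq hI' (fun t => y ^ 2 - (ω - ω⁻¹) * t * y - t ^ 2),
    prod_eq hc (fun t => y ^ 2 + (ω - ω⁻¹) * t * y - t ^ 2)]

/-- The level-two sum of an enlarged index set, as a polynomial in the new entry. -/
lemma levelTwoSum_insert_mul (hω : ω ≠ 0) {n : ι} (hn : n ∉ S)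
    (hx : AdmissibleOn (insert n S) x) :
    levelTwoSum ω q r (insert n S) x * ∏ k ∈ S, (x n ^ 2 - x k ^ 2) =
      (insertPoly ω q r S x).eval (x n) := by
  rw [eval_insertPoly, levelTwoSum, sum_powerset_insert_sdiff hn (fun A B => q ^ #A * r ^ #B *
    ((q + r) * (∑ i ∈ A, x i ^ 2 - ∑ j ∈ B, x j ^ 2) - (q - r) * (∑ i ∈ insert n S, x i) ^ 2) *
    crossProd ω x A B), sum_mul]
  refine sum_congr rfl fun I hI => ?_
  have hIS := mem_powerset.1 hI
  have hnI : n ∉ I := fun h => hn (hIS h)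
  have hnc : n ∉ S \ I := fun h => hn (mem_sdiff.1 h).1
  have hne : ∀ i ∈ S, x i ^ 2 ≠ x n ^ 2 := fun i hi =>
    hx.2 i (mem_insert_of_mem hi) n (mem_insert_self n S) (fun h => hn (h ▸ hi))
  have h1 := prod_ff_right hω I (hx.1 n (mem_insert_self n S)) fun i hi => hne i (hIS hi)
  have h2 := prod_ff_left hω (S \ I) (v := x n)
    (fun i hi => hx.1 i (mem_insert_of_mem (mem_sdiff.1 hi).1))
    fun i hi => hne i (mem_sdiff.1 hi).1
  rw [crossProd_insert_left hnI, crossProd_insert_right hnc, card_insert_of_notMem hnI,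
    card_insert_of_notMem hnc, sum_insert hn, sum_insert hnI, sum_insert hnc,
    ← prod_sdiff hIS, ← h2, ← h1]
  ring

lemma eval_insertPoly_self (hω : ω ≠ 0) {k : ι} (hk : k ∉ S)
    (hx : AdmissibleOn (insert k S) x) :
    (insertPoly ω q r (insert k S) x).eval (x k) = 0 := by
  rw [eval_insertPoly, sum_powerset_insert_sdiff hk (fun A B =>
    (q ^ #A * r ^ #B * crossProd ω x A B) *
    (q * ((q + r) * ((∑ i ∈ A, x i ^ 2 - ∑ j ∈ B, x j ^ 2) + x k ^ 2) -
          (q - r) * ((∑ i ∈ insert k S, x i) + x k) ^ 2) *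
        ((∏ j ∈ B, (x k ^ 2 + (ω - ω⁻¹) * x j * x k - x j ^ 2)) * ∏ i ∈ A, (x k ^ 2 - x i ^ 2)) +
      r * ((q + r) * ((∑ i ∈ A, x i ^ 2 - ∑ j ∈ B, x j ^ 2) - x k ^ 2) -
          (q - r) * ((∑ i ∈ insert k S, x i) + x k) ^ 2) *
        ((∏ i ∈ A, (x k ^ 2 - (ω - ω⁻¹) * x i * x k - x i ^ 2)) *
          ∏ j ∈ B, (x k ^ 2 - x j ^ 2))))]
  refine sum_eq_zero fun I hI => ?_
  have hIS := mem_powerset.1 hI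
  have hkI : k ∉ I := fun h => hk (hIS h)
  have hkc : k ∉ S \ I := fun h => hk (mem_sdiff.1 h).1
  have hne : ∀ i ∈ S, x i ^ 2 ≠ x k ^ 2 := fun i hi =>
    hx.2 i (mem_insert_of_mem hi) k (mem_insert_self k S) (fun h => hk (h ▸ hi))
  have h1 := prod_ff_right hω I (hx.1 k (mem_insert_self k S)) fun i hi => hne i (hIS hi)
  have h2 := prod_ff_left hω (S \ I) (v := x k)
    (fun i hi => hx.1 i (mem_insert_of_mem (mem_sdiff.1 hi).1))
    fun i hi => hne i (mem_sdiff.1 hi).1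
  rw [crossProd_insert_left hkI, crossProd_insert_right hkc, card_insert_of_notMem hkI,
    card_insert_of_notMem hkc, sum_insert hkI, sum_insert hkc]
  simp only [prod_insert hkI, prod_insert hkc]
  rw [← h2, ← h1]
  ring

lemma eval_insertPoly_neg (hω : ω ≠ 0) {k : ι} (hk : k ∉ S)
    (hx : AdmissibleOn (insert k S) x) :
    (insertPoly ω q r (insert k S) x).eval (-x k) =
      q * r * (ω - ω⁻¹) * x k ^ 2 * (∏ i ∈ S, (x k ^ 2 + (ω - ω⁻¹) * x i * x k - x i ^ 2) -
        ∏ i ∈ S, (x k ^ 2 - (ω - ω⁻¹) * x i * x k - x i ^ 2)) * levelTwoSum ω q r S x := by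
  rw [eval_insertPoly, sum_powerset_insert_sdiff hk (fun A B =>
    (q ^ #A * r ^ #B * crossProd ω x A B) *
    (q * ((q + r) * ((∑ i ∈ A, x i ^ 2 - ∑ j ∈ B, x j ^ 2) + (-x k) ^ 2) -
          (q - r) * ((∑ i ∈ insert k S, x i) + -x k) ^ 2) *
        ((∏ j ∈ B, ((-x k) ^ 2 + (ω - ω⁻¹) * x j * -x k - x j ^ 2)) *
          ∏ i ∈ A, ((-x k) ^ 2 - x i ^ 2)) +
      r * ((q + r) * ((∑ i ∈ A, x i ^ 2 - ∑ j ∈ B, x j ^ 2) - (-x k) ^ 2) -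
          (q - r) * ((∑ i ∈ insert k S, x i) + -x k) ^ 2) *
        ((∏ i ∈ A, ((-x k) ^ 2 - (ω - ω⁻¹) * x i * -x k - x i ^ 2)) *
          ∏ j ∈ B, ((-x k) ^ 2 - x j ^ 2)))), levelTwoSum, mul_sum]
  refine sum_congr rfl fun I hI => ?_
  have hIS := mem_powerset.1 hI
  have hkI : k ∉ I := fun h => hk (hIS h)
  have hkc : k ∉ S \ I := fun h => hk (mem_sdiff.1 h).1
  have hne : ∀ i ∈ S, x i ^ 2 ≠ x k ^ 2 := fun i hi =>
    hx.2 i (mem_insert_of_mem hi) k (mem_insert_self k S) (fun h => hk (h ▸ hi))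
  have h1 := prod_ff_right hω I (hx.1 k (mem_insert_self k S)) fun i hi => hne i (hIS hi)
  have h2 := prod_ff_left hω (S \ I) (v := x k)
    (fun i hi => hx.1 i (mem_insert_of_mem (mem_sdiff.1 hi).1))
    fun i hi => hne i (mem_sdiff.1 hi).1
  rw [crossProd_insert_left hkI, crossProd_insert_right hkc, card_insert_of_notMem hkI,
    card_insert_of_notMem hkc, sum_insert hkI, sum_insert hkc, sum_insert hk,
    ← prod_sdiff hIS, ← prod_sdiff hIS]
  simp only [prod_insert hkI, prod_insert hkc, neg_sq, mul_neg, ← sub_eq_add_neg, sub_neg_eq_add]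
  rw [← h2, ← h1]
  ring

lemma eval_insertPoly_zero :
    (insertPoly ω q r S x).eval 0 = (q + r) * (∏ k ∈ S, -x k ^ 2) * levelTwoSum ω q r S x := by
  rw [eval_insertPoly, levelTwoSum, mul_sum]
  refine sum_congr rfl fun I hI => ?_
  rw [← prod_sdiff (mem_powerset.1 hI)]
  simp only [mul_zero, add_zero, sub_zero, zero_sub, ne_eq, OfNat.ofNat_ne_zero,
    not_false_eq_true, zero_pow]
  ring

lemma natDegree_quadratic_combination_le {A B : Polynomial ℂ} {d : ℕ} (hA : A.Monic) (hB : B.Monic)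
    (hAd : A.natDegree = d) (hBd : B.natDegree = d) (P T : ℂ) :
    (Polynomial.C q * (Polynomial.C (q + r) * (Polynomial.C P + Polynomial.X ^ 2) -
        Polynomial.C (q - r) * (Polynomial.C T + Polynomial.X) ^ 2) * A +
      Polynomial.C r * (Polynomial.C (q + r) * (Polynomial.C P - Polynomial.X ^ 2) -
        Polynomial.C (q - r) * (Polynomial.C T + Polynomial.X) ^ 2) * B).natDegree ≤ d + 1 := by
  have key : Polynomial.C q * (Polynomial.C (q + r) * (Polynomial.C P + Polynomial.X ^ 2) -
        Polynomial.C (q - r) * (Polynomial.C T + Polynomial.X) ^ 2) * A +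
      Polynomial.C r * (Polynomial.C (q + r) * (Polynomial.C P - Polynomial.X ^ 2) -
        Polynomial.C (q - r) * (Polynomial.C T + Polynomial.X) ^ 2) * B =
      Polynomial.C (2 * q * r) * (Polynomial.X ^ 2 * (A - B)) +
      (Polynomial.C (-2 * (q - r) * T) * Polynomial.X +
        Polynomial.C ((q + r) * P - (q - r) * T ^ 2)) *
        (Polynomial.C q * A + Polynomial.C r * B) := by
    simp only [map_sub, map_add, map_mul, map_pow, map_neg, map_ofNat]
    ring
  rw [key]
  refine Polynomial.natDegree_add_le_of_degree_le ?_ ?_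
  · refine (Polynomial.natDegree_C_mul_le _ _).trans ?_
    by_cases hAB : A - B = 0
    · simp [hAB]
    have hlt : (A - B).degree < A.degree := Polynomial.degree_sub_lt_left
      (by rw [Polynomial.degree_eq_natDegree hA.ne_zero, Polynomial.degree_eq_natDegree hB.ne_zero,
        hAd, hBd]) hA.ne_zero (by rw [hA.leadingCoeff, hB.leadingCoeff])
    have := Polynomial.natDegree_lt_natDegree hAB hlt
    refine Polynomial.natDegree_mul_le.trans ?_
    rw [Polynomial.natDegree_X_pow]
    omega
  · refine Polynomial.natDegree_mul_le.trans ?_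
    rw [add_comm]
    refine add_le_add ?_ Polynomial.natDegree_linear_le
    exact Polynomial.natDegree_add_le_of_degree_le
      ((Polynomial.natDegree_C_mul_le _ _).trans hAd.le)
      ((Polynomial.natDegree_C_mul_le _ _).trans hBd.le)

lemma monic_prod_quadratics (I : Finset ι) (hI : I ⊆ S) (b : ι → ℂ) :
    ((∏ j ∈ S \ I, (Polynomial.X ^ 2 + Polynomial.C (b j) * Polynomial.X -
        Polynomial.C (x j ^ 2))) *
      ∏ i ∈ I, (Polynomial.X ^ 2 - Polynomial.C (x i ^ 2))).Monic ∧
    ((∏ j ∈ S \ I, (Polynomial.X ^ 2 + Polynomial.C (b j) * Polynomial.X -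
        Polynomial.C (x j ^ 2))) *
      ∏ i ∈ I, (Polynomial.X ^ 2 - Polynomial.C (x i ^ 2))).natDegree = 2 * #S := by
  have m1 (j : ι) : (Polynomial.X ^ 2 + Polynomial.C (b j) * Polynomial.X -
      Polynomial.C (x j ^ 2)).Monic := by monicity!
  have m2 (j : ι) : (Polynomial.X ^ 2 - Polynomial.C (x j ^ 2)).Monic := by monicity!
  have d1 (j : ι) : (Polynomial.X ^ 2 + Polynomial.C (b j) * Polynomial.X -
      Polynomial.C (x j ^ 2)).natDegree = 2 := by compute_degree!
  have d2 (j : ι) : (Polynomial.X ^ 2 - Polynomial.C (x j ^ 2)).natDegree = 2 := by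
    compute_degree!
  have M1 := Polynomial.monic_prod_of_monic (S \ I) _ fun j _ => m1 j
  have M2 := Polynomial.monic_prod_of_monic I _ fun j _ => m2 j
  refine ⟨M1.mul M2, ?_⟩
  rw [M1.natDegree_mul M2, Polynomial.natDegree_prod_of_monic _ _ fun j _ => m1 j,
    Polynomial.natDegree_prod_of_monic _ _ fun j _ => m2 j]
  simp only [d1, d2, sum_const, smul_eq_mul]
  rw [← card_sdiff_add_card_eq_card hI]
  ring

lemma natDegree_insertPoly_le : (insertPoly ω q r S x).natDegree ≤ 2 * #S + 1 := by
  refine Polynomial.natDegree_sum_le_of_forall_le _ _ fun I hI => ?_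
  refine (Polynomial.natDegree_C_mul_le _ _).trans ?_
  have hIS := mem_powerset.1 hI
  obtain ⟨hA, hAd⟩ := monic_prod_quadratics (x := x) I hIS fun j => (ω - ω⁻¹) * x j
  obtain ⟨hB, hBd⟩ := monic_prod_quadratics (x := x) (S \ I) sdiff_subset
    fun j => -((ω - ω⁻¹) * x j)
  simp only [Finset.sdiff_sdiff_eq_self hIS, map_neg, neg_mul, ← sub_eq_add_neg] at hB hBd
  exact natDegree_quadratic_combination_le hA hB hAd hBd _ _

/-- The defect of the reflection relation on the index set `S`. -/
noncomputable def reflectionDefect (ω q r : ℂ) (S : Finset ι) (x : ι → ℂ) : ℂ :=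
  (ω - ω⁻¹ + (q ^ 2 - r ^ 2)) * levelTwoSum ω q r S x -
    (ω - ω⁻¹ - (q ^ 2 - r ^ 2)) * levelTwoSum ω r q S x

/-- A polynomial of degree at most `2 #S + 1` vanishing at `0` and at all `±x_k` is proportional to
`y ∏ (y² - x_k²)`. -/
lemma eval_mul_eq_of_vanish {p : Polynomial ℂ} (hx : AdmissibleOn S x)
    (hp : p.natDegree ≤ 2 * #S + 1) (h0 : p.eval 0 = 0) (hpos : ∀ k ∈ S, p.eval (x k) = 0)
    (hneg : ∀ k ∈ S, p.eval (-x k) = 0) {y : ℂ} (hy : y ≠ 0) (hyS : ∀ k ∈ S, y ^ 2 ≠ x k ^ 2)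
    (z : ℂ) :
    p.eval z * (y * ∏ k ∈ S, (y ^ 2 - x k ^ 2)) = p.eval y * (z * ∏ k ∈ S, (z ^ 2 - x k ^ 2)) := by
  set E : Polynomial ℂ := Polynomial.X * ∏ k ∈ S, (Polynomial.X ^ 2 - Polynomial.C (x k ^ 2))
    with hE
  have hEe (w : ℂ) : E.eval w = w * ∏ k ∈ S, (w ^ 2 - x k ^ 2) := by
    simp [hE, Polynomial.eval_prod]
  have hEd : E.natDegree ≤ 2 * #S + 1 := by
    have h := (monic_prod_quadratics (x := x) S subset_rfl fun _ => 0).2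
    rw [Finset.sdiff_self, prod_empty, one_mul] at h
    refine Polynomial.natDegree_mul_le.trans ?_
    rw [h, Polynomial.natDegree_X, add_comm]
  set R : Finset ℂ := insert y (insert 0 (S.image x ∪ S.image fun k => -x k)) with hR
  have hRc : #R = 2 * #S + 2 := by
    have hinj : Set.InjOn x S := fun i hi j hj hij => by
      by_contra hne
      exact hx.2 i hi j hj hne (by rw [hij])
    have hinj' : Set.InjOn (fun k => -x k) S := fun i hi j hj hij => hinj hi hj (neg_injective hij)
    rw [hR, card_insert_of_notMem, card_insert_of_notMem, card_union_of_disjoint,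
      card_image_of_injOn hinj, card_image_of_injOn hinj']
    · ring
    · rw [disjoint_left]
      simp only [mem_image, not_exists, not_and]
      rintro _ ⟨i, hi, rfl⟩ j hj hij
      by_cases h : i = j
      · subst h
        exact hx.1 i hi (self_eq_neg.1 hij.symm)
      · exact hx.2 i hi j hj h (by rw [← hij, neg_sq])
    · simp only [mem_union, mem_image, neg_eq_zero, or_self]
      rintro ⟨i, hi, h⟩
      exact hx.1 i hi h
    · simp only [mem_insert, mem_union, mem_image, not_or, not_exists, not_and]
      exact ⟨hy, fun i hi h => hyS i hi (by rw [h]), fun i hi h => hyS i hi (by rw [← h, neg_sq])⟩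
  have hzero : Polynomial.C (E.eval y) * p - Polynomial.C (p.eval y) * E = 0 := by
    refine Polynomial.eq_zero_of_natDegree_lt_card_of_eval_eq_zero' _ R ?_ ?_
    · intro w hw
      have hE0 : ∀ k ∈ S, w ^ 2 = x k ^ 2 → E.eval w = 0 := fun k hk h => by
        rw [hEe, prod_eq_zero hk (sub_eq_zero.2 h), mul_zero]
      simp only [Polynomial.eval_sub, Polynomial.eval_mul, Polynomial.eval_C]
      simp only [hR, mem_insert, mem_union, mem_image] at hw
      rcases hw with rfl | rfl | ⟨k, hk, rfl⟩ | ⟨k, hk, rfl⟩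
      · ring
      · rw [h0, hEe 0, zero_mul]
        ring
      · rw [hpos k hk, hE0 k hk rfl]
        ring
      · rw [hneg k hk, hE0 k hk (neg_sq _)]
        ring
    · rw [hRc]
      exact Nat.lt_succ_of_le ((Polynomial.natDegree_sub_le _ _).trans
        (max_le ((Polynomial.natDegree_C_mul_le _ _).trans hp)
          ((Polynomial.natDegree_C_mul_le _ _).trans hEd)))
  have h := congrArg (Polynomial.eval z) hzero
  simp only [Polynomial.eval_sub, Polynomial.eval_mul, Polynomial.eval_C, Polynomial.eval_zero,
    hEe] at h
  linear_combination h

/-- If the defect vanishes on all smaller index sets, it is linear in each entry. -/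
lemma reflectionDefect_scale (hω : ω ≠ 0) {n : ι} (hn : n ∉ S)
    (ih : ∀ T ⊆ S, reflectionDefect ω q r T x = 0) {x' : ι → ℂ} (c : ℂ)
    (hx : AdmissibleOn (insert n S) x) (hx' : AdmissibleOn (insert n S) x')
    (hS : ∀ i ∈ S, x' i = x i) (hc : x' n = c * x n) :
    reflectionDefect ω q r (insert n S) x' = c * reflectionDefect ω q r (insert n S) x := by
  set p : Polynomial ℂ :=
    Polynomial.C (ω - ω⁻¹ + (q ^ 2 - r ^ 2)) * insertPoly ω q r S x -
      Polynomial.C (ω - ω⁻¹ - (q ^ 2 - r ^ 2)) * insertPoly ω r q S x with hp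
  have hpe (y : ℂ) : p.eval y =
      (ω - ω⁻¹ + (q ^ 2 - r ^ 2)) * (insertPoly ω q r S x).eval y -
        (ω - ω⁻¹ - (q ^ 2 - r ^ 2)) * (insertPoly ω r q S x).eval y := by
    simp [hp]
  have hxS := hx.mono (subset_insert n S)
  have hdeg : p.natDegree ≤ 2 * #S + 1 :=
    (Polynomial.natDegree_sub_le _ _).trans
      (max_le ((Polynomial.natDegree_C_mul_le _ _).trans natDegree_insertPoly_le)
        ((Polynomial.natDegree_C_mul_le _ _).trans natDegree_insertPoly_le))
  have h0 : p.eval 0 = 0 := by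
    have h := ih S subset_rfl
    rw [reflectionDefect] at h
    rw [hpe, eval_insertPoly_zero, eval_insertPoly_zero]
    linear_combination (q + r) * (∏ k ∈ S, -x k ^ 2) * h
  have hpos : ∀ k ∈ S, p.eval (x k) = 0 := fun k hk => by
    have e := insert_erase hk
    have h1 (q r : ℂ) : (insertPoly ω q r S x).eval (x k) = 0 := by
      have := eval_insertPoly_self (q := q) (r := r) hω (notMem_erase k S) (x := x) (by rwa [e])
      rwa [e] at this
    rw [hpe, h1, h1]
    ring
  have hneg : ∀ k ∈ S, p.eval (-x k) = 0 := fun k hk => by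
    have e := insert_erase hk
    have h1 (q r : ℂ) := eval_insertPoly_neg (q := q) (r := r) hω (notMem_erase k S) (x := x)
      (by rwa [e])
    rw [e] at h1
    have h := ih (S.erase k) (erase_subset k S)
    rw [reflectionDefect] at h
    rw [hpe, h1, h1]
    linear_combination (q * r * (ω - ω⁻¹) * x k ^ 2 *
      (∏ i ∈ S.erase k, (x k ^ 2 + (ω - ω⁻¹) * x i * x k - x i ^ 2) -
        ∏ i ∈ S.erase k, (x k ^ 2 - (ω - ω⁻¹) * x i * x k - x i ^ 2))) * h
  have hnS := mem_insert_self n S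
  have hne : ∀ k ∈ S, n ≠ k := fun k hk h => hn (h ▸ hk)
  have hval {u : ι → ℂ} (hu : AdmissibleOn (insert n S) u) (huS : ∀ i ∈ S, u i = x i) :
      reflectionDefect ω q r (insert n S) u * ∏ k ∈ S, (u n ^ 2 - x k ^ 2) = p.eval (u n) := by
    have h1 (q r : ℂ) := levelTwoSum_insert_mul (q := q) (r := r) hω hn hu
    simp only [insertPoly_congr huS] at h1
    rw [prod_congr rfl fun k hk => by rw [huS k hk]] at h1
    rw [hpe, reflectionDefect, ← h1, ← h1]
    ring
  have hprod {u : ι → ℂ} (hu : AdmissibleOn (insert n S) u) (huS : ∀ i ∈ S, u i = x i) :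
      ∏ k ∈ S, (u n ^ 2 - x k ^ 2) ≠ 0 :=
    prod_ne_zero_iff.2 fun k hk => sub_ne_zero.2 <| by
      rw [← huS k hk]
      exact hu.2 n hnS k (mem_insert_of_mem hk) (hne k hk)
  have hmain := eval_mul_eq_of_vanish hxS hdeg h0 hpos hneg (hx.1 n hnS)
    (fun k hk => hx.2 n hnS k (mem_insert_of_mem hk) (hne k hk)) (x' n)
  rw [← hval hx fun _ _ => rfl, ← hval hx' hS] at hmain
  refine mul_right_cancel₀ (mul_ne_zero (mul_ne_zero (hprod hx' hS)
    (hprod hx fun _ _ => rfl)) (hx.1 n hnS)) ?_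
  rw [hc] at hmain ⊢
  linear_combination hmain

lemma levelTwoSum_smul {c : ℂ} (hc : c ≠ 0) :
    levelTwoSum ω q r S (fun i => c * x i) = c ^ 2 * levelTwoSum ω q r S x := by
  simp only [levelTwoSum, crossProd, mul_sum, mul_div_mul_left _ _ hc, mul_pow]
  refine sum_congr rfl fun I _ => ?_
  simp only [← mul_sum]
  ring

lemma reflectionDefect_empty : reflectionDefect ω q r ∅ x = 0 := by
  simp [reflectionDefect, levelTwoSum]

lemma reflectionDefect_singleton (i : ι) : reflectionDefect ω q r {i} x = 0 := by
  have h (q r : ℂ) : levelTwoSum ω q r {i} x = 0 := by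
    have := sum_powerset_insert_sdiff (S := ∅) (n := i) (notMem_empty i)
      (fun A B => q ^ #A * r ^ #B *
        ((q + r) * (∑ i ∈ A, x i ^ 2 - ∑ j ∈ B, x j ^ 2) -
          (q - r) * (∑ i ∈ insert i (∅ : Finset ι), x i) ^ 2) * crossProd ω x A B)
    rw [insert_empty_eq] at this
    rw [levelTwoSum, this]
    simp [crossProd]
    ring
  simp [reflectionDefect, h]

lemma reflectionDefect_pair (hω : ω ≠ 0) (hqr : q * r = 1) {i j : ι} (hij : i ≠ j)
    (hx : AdmissibleOn {i, j} x) : reflectionDefect ω q r {i, j} x = 0 := by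
  have hi : x i ≠ 0 := hx.1 i (by simp)
  have hj : x j ≠ 0 := hx.1 j (by simp)
  have hne : x i ^ 2 ≠ x j ^ 2 := hx.2 i (by simp) j (by simp) hij
  have f1 := ff_div_mul_s12 hω hj hne
  have f2 := ff_div_mul_s12 hω hi hne.symm
  have hs : ff ω (x i / x j) + ff ω (x j / x i) = 2 :=
    mul_right_cancel₀ (sub_ne_zero.2 hne) (by linear_combination f2 - f1)
  have h (q r : ℂ) (hqr : q * r = 1) : levelTwoSum ω q r {i, j} x =
      2 * (q + r) * x i * x j * (ω - ω⁻¹ - (q ^ 2 - r ^ 2)) := by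
    have e1 := sum_powerset_insert_sdiff (S := {j}) (n := i) (by simpa using hij)
      (fun A B => q ^ #A * r ^ #B *
        ((q + r) * (∑ i ∈ A, x i ^ 2 - ∑ j ∈ B, x j ^ 2) -
          (q - r) * (∑ i ∈ ({i, j} : Finset ι), x i) ^ 2) * crossProd ω x A B)
    rw [levelTwoSum, e1, ← insert_empty_eq j, sum_powerset_insert (notMem_empty j), powerset_empty,
      sum_singleton, sum_singleton]
    simp only [crossProd, insert_empty_eq, sdiff_empty, Finset.sdiff_self, card_empty, sum_empty,
      prod_empty, prod_const_one, card_singleton, sum_singleton, prod_singleton, sum_pair hij,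
      card_pair hij]
    linear_combination -(q + r) * q * r * (f1 + f2) - (q - r) * (x i + x j) ^ 2 * q * r * hs +
      2 * (q + r) * x i * x j * (ω - ω⁻¹) * hqr
  rw [reflectionDefect, h q r hqr, h r q (by rw [mul_comm, hqr])]
  ring

lemma reflectionDefect_smul_subset {c : ℂ} (hω : ω ≠ 0)
    (ih : ∀ T ⊂ S, ∀ u : ι → ℂ, AdmissibleOn T u → reflectionDefect ω q r T u = 0)
    (hx : ∀ T ⊆ S, AdmissibleOn S fun i => if i ∈ T then c * x i else x i)
    (T : Finset ι) (hT : T ⊆ S) :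
    reflectionDefect ω q r S (fun i => if i ∈ T then c * x i else x i) =
      c ^ #T * reflectionDefect ω q r S x := by
  induction T using Finset.induction_on with
  | empty => simp
  | insert n T hnT hrec =>
    have hT' := (subset_insert n T).trans hT
    have hnS : n ∈ S := hT (mem_insert_self n T)
    have e := insert_erase hnS
    have hscale := reflectionDefect_scale (q := q) (r := r) hω (notMem_erase n S)
      (x := fun i => if i ∈ T then c * x i else x i)
      (x' := fun i => if i ∈ insert n T then c * x i else x i)
      (fun U hU => ih U (hU.trans_ssubset (erase_ssubset hnS)) _
        ((hx T hT').mono (hU.trans (erase_subset n S)))) c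
      (by rw [e]; exact hx T hT') (by rw [e]; exact hx _ hT)
      (fun i hi => by simp [ne_of_mem_erase hi]) (by simp [hnT])
    rw [e, hrec hT'] at hscale
    rw [hscale, card_insert_of_notMem hnT]
    ring

/-- A scale factor that keeps all partial rescalings of an admissible tuple admissible. -/
lemma AdmissibleOn.exists_scale (hx : AdmissibleOn S x) : ∃ c : ℝ, 1 < c ∧
    ∀ T ⊆ S, AdmissibleOn S fun i => if i ∈ T then (c : ℂ) * x i else x i := by
  rcases S.eq_empty_or_nonempty with rfl | ⟨k, hk⟩
  · exact ⟨2, by norm_num, fun T _ => ⟨by simp, by simp⟩⟩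
  set c : ℝ := 1 + ∑ i ∈ S, ∑ j ∈ S, ‖x j‖ / ‖x i‖ with hc
  have hle : ∀ i ∈ S, ∀ j ∈ S, ‖x j‖ / ‖x i‖ < c := fun i hi j hj => by
    have h1 : ‖x j‖ / ‖x i‖ ≤ ∑ j ∈ S, ‖x j‖ / ‖x i‖ :=
      single_le_sum (f := fun j => ‖x j‖ / ‖x i‖) (fun _ _ => by positivity) hj
    have h2 : ∑ j ∈ S, ‖x j‖ / ‖x i‖ ≤ ∑ i ∈ S, ∑ j ∈ S, ‖x j‖ / ‖x i‖ :=
      single_le_sum (f := fun i => ∑ j ∈ S, ‖x j‖ / ‖x i‖)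
        (fun _ _ => sum_nonneg fun _ _ => by positivity) hi
    linarith
  have hc1 : 1 < c := by
    simpa [div_self (norm_ne_zero_iff.2 (hx.1 k hk))] using hle k hk k hk
  have hc0 : (c : ℂ) ≠ 0 := by exact_mod_cast (by linarith : c ≠ 0)
  have hmixed : ∀ i ∈ S, ∀ j ∈ S, ((c : ℂ) * x i) ^ 2 ≠ x j ^ 2 := fun i hi j hj h => by
    have hlt := (div_lt_iff₀ (norm_pos_iff.2 (hx.1 i hi))).1 (hle i hi j hj)
    have h' := congrArg norm h
    rw [norm_pow, norm_pow, norm_mul, Complex.norm_real, Real.norm_of_nonneg (by linarith)] at h'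
    exact hlt.ne' ((pow_left_inj₀ (by positivity) (norm_nonneg _) two_ne_zero).1 h')
  refine ⟨c, hc1, fun T _ => ⟨fun i hi => ?_, fun i hi j hj hij => ?_⟩⟩
  · dsimp only
    split_ifs
    exacts [mul_ne_zero hc0 (hx.1 i hi), hx.1 i hi]
  · dsimp only
    split_ifs
    · rw [mul_pow, mul_pow]
      exact fun h => hx.2 i hi j hj hij (mul_left_cancel₀ (pow_ne_zero 2 hc0) h)
    · exact hmixed i hi j hj
    · exact (hmixed j hj i hi).symm
    · exact hx.2 i hi j hj hij

theorem reflectionDefect_eq_zero (hω : ω ≠ 0) (hqr : q * r = 1) (S : Finset ι) (x : ι → ℂ)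
    (hx : AdmissibleOn S x) : reflectionDefect ω q r S x = 0 := by
  induction S using Finset.strongInduction generalizing x with
  | H S ih =>
  by_cases h3 : 3 ≤ #S
  · obtain ⟨c, hc1, hc⟩ := hx.exists_scale
    have hc0 : (c : ℂ) ≠ 0 := by exact_mod_cast (by linarith : c ≠ 0)
    have h1 := reflectionDefect_smul_subset (q := q) (r := r) hω ih hc S subset_rfl
    have h2 : reflectionDefect ω q r S (fun i => if i ∈ S then (c : ℂ) * x i else x i) =
        (c : ℂ) ^ 2 * reflectionDefect ω q r S x := by
      have hcongr (q r : ℂ) : levelTwoSum ω q r S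
          (fun i => if i ∈ S then (c : ℂ) * x i else x i) = (c : ℂ) ^ 2 * levelTwoSum ω q r S x := by
        rw [← levelTwoSum_smul hc0]
        exact levelTwoSum_congr fun i hi => by simp [hi]
      rw [reflectionDefect, reflectionDefect, hcongr, hcongr]
      ring
    have hne : (c : ℂ) ^ #S - (c : ℂ) ^ 2 ≠ 0 := by
      rw [sub_ne_zero]
      exact_mod_cast (pow_lt_pow_right₀ hc1 h3).ne'
    refine (mul_eq_zero.1 ?_).resolve_left hne
    linear_combination h2 - h1
  · have h : #S = 0 ∨ #S = 1 ∨ #S = 2 := by omega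
    rcases h with h | h | h
    · rw [card_eq_zero.1 h]
      exact reflectionDefect_empty
    · obtain ⟨i, rfl⟩ := card_eq_one.1 h
      exact reflectionDefect_singleton i
    · obtain ⟨i, j, hij, rfl⟩ := card_eq_two.1 h
      exact reflectionDefect_pair hω hqr hij hx

end LevelTwo

lemma phase_eq {q r a : ℂ} (hq : q = Complex.exp (Complex.I * (Real.pi : ℂ) * a))
    (hr : r = Complex.exp (-(Complex.I * (Real.pi : ℂ) * a))) {N : ℕ} (I : Finset (Fin N)) :
    phase a N #I = q ^ #I * r ^ #Iᶜ := by
  have h : ((#I : ℕ) : ℂ) + (#Iᶜ : ℕ) = N := by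
    rw [← Nat.cast_add, card_add_card_compl, Fintype.card_fin]
  rw [phase, hq, hr, ← Complex.exp_nat_mul, ← Complex.exp_nat_mul, ← Complex.exp_add, ← h]
  congr 1
  ring

lemma J_combination {q r a : ℂ} (hq : q = Complex.exp (Complex.I * (Real.pi : ℂ) * a))
    (hr : r = Complex.exp (-(Complex.I * (Real.pi : ℂ) * a))) (ω : ℂ) {N : ℕ} (X : Fin N → ℂ) :
    (q + r) * J ω k2 2 a X - (q - r) * J ω k11 1 a X = levelTwoSum ω q r univ X := by
  rw [J, J, mul_sum, mul_sum, ← sum_sub_distrib, levelTwoSum, powerset_univ]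
  refine sum_congr rfl fun I _ => ?_
  have h2 : Ph k2 2 X I Iᶜ = ∑ i ∈ I, X i ^ 2 - ∑ j ∈ Iᶜ, X j ^ 2 := by
    simp [Ph, k2, pS, show Finset.Icc 1 2 = {1, 2} from rfl]
  have h1 : Ph k11 1 X I Iᶜ = (∑ i, X i) ^ 2 := by
    simp [Ph, k11, pS, sum_add_sum_compl]
  rw [phase_eq hq hr, h1, h2, ← compl_eq_univ_sdiff, crossProd]
  ring

/-- reflection relation for the level-(2,0) descendants: for `cos πa ≠ 0` and
admissible `X`,
`(sin πp + sin 2πa)·(J^{(2)}_{N,a}(X) − i·tan πa·J^{(1,1)}_{N,a}(X))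
  = (sin πp − sin 2πa)·(J^{(2)}_{N,−a}(X) + i·tan πa·J^{(1,1)}_{N,−a}(X))`,
with `sin πp = (ω−ω⁻¹)/(2i)`, `tan πa = sin πa/cos πa`, `sin 2πa = 2 sin πa cos πa`. -/
theorem stmt12 (ω : ℂ) (hω : ω ≠ 0 ∧ ω ≠ 1 ∧ ω ≠ -1) (a : ℂ) (hcos : cosπ a ≠ 0)
    (N : ℕ) (X : Fin N → ℂ) (hadm : Admissible X) :
    ((ω - ω⁻¹) / (2 * Complex.I) + 2 * sinπ a * cosπ a) *
      (J ω k2 2 a X - Complex.I * (sinπ a / cosπ a) * J ω k11 1 a X)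
    = ((ω - ω⁻¹) / (2 * Complex.I) - 2 * sinπ a * cosπ a) *
      (J ω k2 2 (-a) X + Complex.I * (sinπ a / cosπ a) * J ω k11 1 (-a) X) := by
  have hqr : Complex.exp (Complex.I * (Real.pi : ℂ) * a) *
      Complex.exp (-(Complex.I * (Real.pi : ℂ) * a)) = 1 := by
    rw [← Complex.exp_add, add_neg_cancel, Complex.exp_zero]
  have hX : AdmissibleOn univ X :=
    ⟨fun i _ => hadm.1 i, fun i _ j _ hij h =>
      (sq_eq_sq_iff_eq_or_eq_neg.1 h).elim (hadm.2 i j hij).1 (hadm.2 i j hij).2⟩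
  have hdef := reflectionDefect_eq_zero hω.1 hqr univ X hX
  rw [reflectionDefect, ← J_combination rfl rfl,
    ← J_combination (a := -a) (by rw [mul_neg]) (by rw [mul_neg, neg_neg])] at hdef
  unfold cosπ at hcos
  unfold cosπ sinπ
  set q := Complex.exp (Complex.I * (Real.pi : ℂ) * a)
  set r := Complex.exp (-(Complex.I * (Real.pi : ℂ) * a))
  have hqr0 : q + r ≠ 0 := fun h => hcos (by rw [h, zero_div])
  have htan : Complex.I * ((q - r) / (2 * Complex.I) / ((q + r) / 2)) = (q - r) / (q + r) := by
    field_simp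
  have hsin : 2 * ((q - r) / (2 * Complex.I)) * ((q + r) / 2) =
      (q ^ 2 - r ^ 2) / (2 * Complex.I) := by
    field_simp
    ring
  have hI := Complex.I_ne_zero
  rw [htan, hsin]
  generalize ω - ω⁻¹ = s at hdef ⊢
  field_simp
  linear_combination hdef
end
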